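/- arXiv:1805.03967 — 2 statements merged into one kernel-verified Lean document; each statement's English description precedes it below -/
import Mathlib

section
/- Let A ∈ ℂ^{I₁×I₂×I₃} and B ∈ ℂ^{I₂×I₄×I₃}, and let C = A ∗ B ∈ ℂ^{I₁×I₄×I₃} be their t-product. Let ω = exp(−2πi/I₃) and define the discrete Fourier transform along the third mode by Â(i₁,i₂,k) = Σ_{j=1}^{I₃} A(i₁,i₂,j) ω^{(j−1)(k−1)}, and similarly B̂ and Ĉ. Then for every k ∈ {1,…,I₃}, the k-th frontal slice of Ĉ equals the matrix product of the k-th frontal slices of Â and B̂: Ĉ^{(k)} = Â^{(k)} B̂^{(k)}, where Ĉ^{(k)}(i₁,i₄) = Ĉ(i₁,i₄,k). In other words, the t-product reduces to slice-wise matrix multiplication in the Fourier domain. -/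
/-- The discrete Fourier transform of a tube `a ∈ ℂ^{I₃}` (0-indexed):
`â(k) = Σ_j a(j) ω^(j k)` with `ω = exp(-2πi/I₃)`. -/
noncomputable def dft {I₃ : ℕ} (a : Fin I₃ → ℂ) : Fin I₃ → ℂ :=
  fun k => ∑ j : Fin I₃, a j * Complex.exp (-(2 * (Real.pi : ℂ) * Complex.I) / (I₃ : ℂ)) ^ (j.1 * k.1)

theorem exp_neg_two_pi_I_div_pow_self (n : ℕ) [NeZero n] :
    Complex.exp (-(2 * (Real.pi : ℂ) * Complex.I) / (n : ℂ)) ^ n = 1 := by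
  rw [← Complex.exp_nat_mul, mul_div_cancel₀ _ (Nat.cast_ne_zero.mpr (NeZero.ne n)),
    Complex.exp_neg, Complex.exp_two_pi_mul_I, inv_one]

/-- Powers of an `n`-th root of unity turn addition in `Fin n` into multiplication. -/
theorem pow_val_add_mul_of_pow_eq_one {M : Type*} [CommMonoid M] {n : ℕ} {w : M} (hw : w ^ n = 1)
    (i j : Fin n) (k : ℕ) :
    w ^ ((i + j).1 * k) = w ^ (i.1 * k) * w ^ (j.1 * k) := by
  rw [pow_mul, Fin.val_add, ← pow_eq_pow_mod _ hw, pow_add, mul_pow, ← pow_mul, ← pow_mul]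

theorem dft_sum {n : ℕ} {ι : Type*} (s : Finset ι) (f : ι → Fin n → ℂ) (k : Fin n) :
    dft (fun m => ∑ i ∈ s, f i m) k = ∑ i ∈ s, dft (f i) k := by
  simp only [dft, Finset.sum_mul]
  exact Finset.sum_comm

/-- The convolution theorem for the discrete Fourier transform. -/
theorem dft_circular_convolution {n : ℕ} (a b : Fin n → ℂ) (k : Fin n) :
    dft (fun m => ∑ j, a j * b (m - j)) k = dft a k * dft b k := by
  have : NeZero n := ⟨(Fin.pos k).ne'⟩
  rw [dft_sum]
  simp only [dft]
  rw [Finset.sum_mul]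
  refine Finset.sum_congr rfl fun j _ => ?_
  rw [← Equiv.sum_comp (Equiv.addRight j), Finset.mul_sum]
  refine Finset.sum_congr rfl fun m _ => ?_
  rw [Equiv.coe_addRight, add_sub_cancel_right,
    pow_val_add_mul_of_pow_eq_one (exp_neg_two_pi_I_div_pow_self n)]
  ring

/-- 0-indexed.  Let `A ∈ ℂ^{I₁×I₂×I₃}`, `B ∈ ℂ^{I₂×I₄×I₃}` and
let `C = A ∗ B ∈ ℂ^{I₁×I₄×I₃}` be their t-product, i.e.
`C(i₁,i₄,k) = Σ_{i₂} Σ_j A(i₁,i₂,j) B(i₂,i₄,(k-j) mod I₃)` (circular convolution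
of tubes; `k - j` below is subtraction in `Fin I₃`, i.e. mod `I₃`).  Then for
every `k`, the `k`-th frontal slice of the DFT (along the third mode) of `C` is
the matrix product of the `k`-th frontal slices of the DFTs of `A` and `B`: the
t-product reduces to slice-wise matrix multiplication in the Fourier domain. -/
theorem tprod_dft_slicewise_matmul
    (I₁ I₂ I₄ I₃ : ℕ)
    (A : Fin I₁ → Fin I₂ → Fin I₃ → ℂ) (B : Fin I₂ → Fin I₄ → Fin I₃ → ℂ)
    (C : Fin I₁ → Fin I₄ → Fin I₃ → ℂ)
    (hC : ∀ (i₁ : Fin I₁) (i₄ : Fin I₄) (k : Fin I₃),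
      C i₁ i₄ k = ∑ i₂ : Fin I₂, ∑ j : Fin I₃, A i₁ i₂ j * B i₂ i₄ (k - j))
    (k : Fin I₃) :
    (Matrix.of fun (i₁ : Fin I₁) (i₄ : Fin I₄) => dft (C i₁ i₄) k)
      = (Matrix.of fun (i₁ : Fin I₁) (i₂ : Fin I₂) => dft (A i₁ i₂) k)
        * (Matrix.of fun (i₂ : Fin I₂) (i₄ : Fin I₄) => dft (B i₂ i₄) k) := by
  ext i₁ i₄
  simp only [Matrix.mul_apply, Matrix.of_apply]
  rw [funext (hC i₁ i₄), dft_sum]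
  simp only [dft_circular_convolution]
end

section
/- Every real 3-order tensor A ∈ ℝ^{I₁×I₂×I₃} admits a t-SVD: there exist tensors U ∈ ℝ^{I₁×I₁×I₃}, S ∈ ℝ^{I₁×I₂×I₃}, V ∈ ℝ^{I₂×I₂×I₃} such that A = U ∗ S ∗ Vᵀ, where U is orthogonal in the t-product sense (U ∗ Uᵀ = Uᵀ ∗ U = I ∈ ℝ^{I₁×I₁×I₃}), V is orthogonal in the t-product sense (V ∗ Vᵀ = Vᵀ ∗ V = I ∈ ℝ^{I₂×I₂×I₃}), and S is f-diagonal, i.e., every frontal slice S(:,:,k) is a diagonal matrix. -/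
/-- The t-product `A ∗ B ∈ ℝ^{I₁×I₄×I₃}` of `A ∈ ℝ^{I₁×I₂×I₃}` and
`B ∈ ℝ^{I₂×I₄×I₃}`: `(A ∗ B)(i₁,i₄,k) = Σ_{i₂} Σ_j A(i₁,i₂,j) B(i₂,i₄,(k-j) mod I₃)`
(circular convolution of tubes; `k - j` is subtraction in `Fin I₃`). -/
noncomputable def tProd {I₁ I₂ I₄ I₃ : ℕ}
    (A : Fin I₁ → Fin I₂ → Fin I₃ → ℝ) (B : Fin I₂ → Fin I₄ → Fin I₃ → ℝ) :
    Fin I₁ → Fin I₄ → Fin I₃ → ℝ :=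
  fun i₁ i₄ k => ∑ i₂ : Fin I₂, ∑ j : Fin I₃, A i₁ i₂ j * B i₂ i₄ (k - j)

/-- The tensor transpose `Aᵀ ∈ ℝ^{I₂×I₁×I₃}` of `A ∈ ℝ^{I₁×I₂×I₃}`: transpose
each frontal slice and reverse the order of the transposed frontal slices
`2, …, I₃` (0-indexed: slice `k` of `Aᵀ` is the transpose of slice `-k mod I₃`). -/
def ttrans {I₁ I₂ I₃ : ℕ} (A : Fin I₁ → Fin I₂ → Fin I₃ → ℝ) :
    Fin I₂ → Fin I₁ → Fin I₃ → ℝ :=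
  fun i₂ i₁ k => A i₁ i₂ (-k)

/-- The identity tensor `I ∈ ℝ^{n×n×I₃}`: the first frontal slice is the
identity matrix and all other frontal slices are zero. -/
def tid (n I₃ : ℕ) : Fin n → Fin n → Fin I₃ → ℝ :=
  fun i j k => if i = j ∧ (k : ℕ) = 0 then 1 else 0

open Matrix Module

/-- The vectors `T (v i)`, for `v` a sorted eigenbasis of `T* T`, are pairwise orthogonal, and they
vanish for `i` beyond the dimension of the codomain. -/
theorem LinearMap.exists_orthonormalBasis_inner_map_eq_zero {𝕜 E F : Type*} [RCLike 𝕜]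
    [NormedAddCommGroup E] [InnerProductSpace 𝕜 E] [FiniteDimensional 𝕜 E]
    [NormedAddCommGroup F] [InnerProductSpace 𝕜 F] [FiniteDimensional 𝕜 F]
    (T : E →ₗ[𝕜] F) {n : ℕ} (hn : finrank 𝕜 E = n) :
    ∃ v : OrthonormalBasis (Fin n) 𝕜 E,
      (∀ i j, i ≠ j → inner 𝕜 (T (v i)) (T (v j)) = 0) ∧
      ∀ i : Fin n, finrank 𝕜 F ≤ i → T (v i) = 0 := by
  set v := T.isSymmetric_adjoint_comp_self.eigenvectorBasis hn
  have key : ∀ i j, inner 𝕜 (T (v i)) (T (v j)) =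
      ((T.singularValues j ^ 2 : ℝ) : 𝕜) * inner 𝕜 (v i) (v j) := by
    intro i j
    rw [← LinearMap.adjoint_inner_right, ← LinearMap.comp_apply,
      T.isSymmetric_adjoint_comp_self.apply_eigenvectorBasis hn, inner_smul_right,
      T.sq_singularValues_fin hn]
  refine ⟨v, fun i j hij => ?_, fun i hi => ?_⟩
  · rw [key, v.orthonormal.2 hij, mul_zero]
  · have h0 : T.singularValues i = 0 :=
      T.singularValues_eq_zero_iff_le_finrank_range.2 (T.range.finrank_le.trans hi)
    rw [← inner_self_eq_zero (𝕜 := 𝕜), key, h0]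
    simp

/-- Bases with respect to which a linear map between inner product spaces is diagonal. -/
theorem LinearMap.exists_orthonormalBasis_inner_eq_zero {𝕜 E F : Type*} [RCLike 𝕜]
    [NormedAddCommGroup E] [InnerProductSpace 𝕜 E] [FiniteDimensional 𝕜 E]
    [NormedAddCommGroup F] [InnerProductSpace 𝕜 F] [FiniteDimensional 𝕜 F]
    (T : E →ₗ[𝕜] F) {m n : ℕ} (hn : finrank 𝕜 E = n) (hm : finrank 𝕜 F = m) :
    ∃ (v : OrthonormalBasis (Fin n) 𝕜 E) (u : OrthonormalBasis (Fin m) 𝕜 F),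
      ∀ (i : Fin m) (j : Fin n), (i : ℕ) ≠ j → inner 𝕜 (u i) (T (v j)) = 0 := by
  obtain ⟨v, horth, hzero⟩ := T.exists_orthonormalBasis_inner_map_eq_zero hn
  let y : Fin m → F := fun i => if h : (i : ℕ) < n then T (v ⟨i, h⟩) else 0
  have hy : ∀ i j : Fin m, i ≠ j → inner 𝕜 (y i) (y j) = 0 := by
    intro i j hij
    simp only [y]
    split_ifs with hi hj
    · exact horth _ _ fun h => hij (Fin.ext (Fin.mk.inj_iff.1 h))
    all_goals simp
  let s : Set (Fin m) := {i | y i ≠ 0}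
  have hs : Orthonormal 𝕜 (s.domRestrict fun i => ((‖y i‖ : 𝕜)⁻¹) • y i) := by
    refine ⟨fun i => norm_smul_inv_norm i.2, fun i j hij => ?_⟩
    simp only [Set.domRestrict_apply, inner_smul_left, inner_smul_right,
      hy i j fun h => hij (Subtype.ext h), mul_zero]
  obtain ⟨u, hu⟩ := hs.exists_orthonormalBasis_extension_of_card_eq (by simp [hm])
  refine ⟨v, u, fun i j hij => ?_⟩
  by_cases h0 : T (v j) = 0
  · rw [h0, inner_zero_right]
  have hjm : (j : ℕ) < m := by
    by_contra! h
    exact h0 (hzero j (hm ▸ h))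
  have hyj : y ⟨j, hjm⟩ = T (v j) := by simp [y]
  have hmem : (⟨j, hjm⟩ : Fin m) ∈ s := by simpa [s, hyj] using h0
  have huj := hu _ hmem
  have hT : T (v j) = (‖T (v j)‖ : 𝕜) • u ⟨j, hjm⟩ := by
    rw [huj, hyj, smul_smul, mul_inv_cancel₀ (by simpa using h0), one_smul]
  rw [hT, inner_smul_right, u.orthonormal.2 fun h => hij (congrArg Fin.val h), mul_zero]

/-- The matrix with the vectors of an orthonormal basis as its columns is unitary. -/
theorem OrthonormalBasis.of_mem_unitaryGroup {𝕜 : Type*} [RCLike 𝕜] {n : Type*} [Fintype n]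
    [DecidableEq n] (u : OrthonormalBasis n 𝕜 (EuclideanSpace 𝕜 n)) :
    (Matrix.of fun i j => u j i) ∈ unitaryGroup n 𝕜 := by
  rw [mem_unitaryGroup_iff']
  ext i j
  have h := orthonormal_iff_ite.1 u.orthonormal i j
  rw [EuclideanSpace.inner_eq_star_dotProduct, dotProduct_comm] at h
  rw [one_apply, ← h]
  rfl

/-- Existence of singular value decompositions. -/
theorem Matrix.exists_svd {𝕜 : Type*} [RCLike 𝕜] {m n : ℕ} (A : Matrix (Fin m) (Fin n) 𝕜) :
    ∃ U ∈ unitaryGroup (Fin m) 𝕜, ∃ V ∈ unitaryGroup (Fin n) 𝕜, ∃ S : Matrix (Fin m) (Fin n) 𝕜,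
      A = U * S * Vᴴ ∧ ∀ (i : Fin m) (j : Fin n), (i : ℕ) ≠ j → S i j = 0 := by
  obtain ⟨v, u, h⟩ := (toEuclideanLin A).exists_orthonormalBasis_inner_eq_zero
    finrank_euclideanSpace_fin finrank_euclideanSpace_fin
  set U : Matrix (Fin m) (Fin m) 𝕜 := Matrix.of fun i j => u j i with hU
  set V : Matrix (Fin n) (Fin n) 𝕜 := Matrix.of fun i j => v j i with hV
  have hUm : U ∈ unitaryGroup (Fin m) 𝕜 := u.of_mem_unitaryGroup
  have hVm : V ∈ unitaryGroup (Fin n) 𝕜 := v.of_mem_unitaryGroup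
  refine ⟨U, hUm, V, hVm, Uᴴ * (A * V), ?_, fun i j hij => ?_⟩
  · have hU1 : U * Uᴴ = 1 := mem_unitaryGroup_iff.1 hUm
    have hV1 : V * Vᴴ = 1 := mem_unitaryGroup_iff.1 hVm
    rw [← Matrix.mul_assoc, hU1, Matrix.one_mul, Matrix.mul_assoc, hV1, Matrix.mul_one]
  · rw [← h i j hij, EuclideanSpace.inner_eq_star_dotProduct, dotProduct_comm]
    rfl

/-- A family of nonempty predicates on `X` compatible with negation on `ZMod N` and an involution of
`X` has an equivariant choice function, provided there are invariant choices at the points of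
order two. -/
theorem ZMod.exists_equivariant_choice {N : ℕ} [NeZero N] {X : Type*} (σ : X → X)
    (hσ : Function.Involutive σ) (P : ZMod N → X → Prop) (hP : ∀ k x, P k x → P (-k) (σ x))
    (hex : ∀ k, ∃ x, P k x) (hfix : ∀ k, -k = k → ∃ x, P k x ∧ σ x = x) :
    ∃ f : ZMod N → X, ∀ k, P k (f k) ∧ f (-k) = σ (f k) := by
  choose g hg using hex
  choose h hh using hfix
  refine ⟨fun k => if e : -k = k then h k e else if k.val < (-k).val then g k else σ (g (-k)),
    fun k => ?_⟩
  by_cases e : -k = k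
  · have e' : -(-k) = -k := by rw [neg_neg, e]
    simp only [e, dif_pos]
    exact ⟨(hh k e).1, (hh k e).2.symm⟩
  · have e' : ¬ k = -k := fun h => e h.symm
    have hne : k.val ≠ (-k).val := fun hv => e' (ZMod.val_injective N hv)
    rcases hne.lt_or_gt with hlt | hlt
    · simp [e, e', hlt, hlt.not_gt, hg]
    · simp only [neg_neg, e, e', hlt, hlt.not_gt, dite_false, if_true, if_false, hσ _, and_true]
      simpa using hP _ _ (hg (-k))

/-- The singular value decompositions of a conjugation-symmetric family of matrices can be chosen
in a conjugation-symmetric way. -/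
theorem Matrix.exists_svd_of_map_star {N m n : ℕ} [NeZero N]
    (M : ZMod N → Matrix (Fin m) (Fin n) ℂ) (hM : ∀ k, M (-k) = (M k).map star) :
    ∃ (U : ZMod N → Matrix (Fin m) (Fin m) ℂ) (S : ZMod N → Matrix (Fin m) (Fin n) ℂ)
      (V : ZMod N → Matrix (Fin n) (Fin n) ℂ),
      (∀ k, U (-k) = (U k).map star) ∧ (∀ k, S (-k) = (S k).map star) ∧
      (∀ k, V (-k) = (V k).map star) ∧
      ∀ k, U k ∈ unitaryGroup (Fin m) ℂ ∧ V k ∈ unitaryGroup (Fin n) ℂ ∧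
        M k = U k * S k * (V k)ᴴ ∧ ∀ (i : Fin m) (j : Fin n), (i : ℕ) ≠ j → S k i j = 0 := by
  have hstar : ∀ {a b : ℕ} (B : Matrix (Fin a) (Fin b) ℂ), (B.map star).map star = B :=
    fun B => by ext; simp
  have hunit : ∀ {a : ℕ} (B : Matrix (Fin a) (Fin a) ℂ), B ∈ unitaryGroup (Fin a) ℂ →
      B.map star ∈ unitaryGroup (Fin a) ℂ := by
    intro a B hB
    rw [mem_unitaryGroup_iff] at hB ⊢
    have h := congrArg (fun C => C.map (starRingEnd ℂ)) hB
    simp only [Matrix.map_mul] at h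
    simpa [star_eq_conjTranspose, conjTranspose, Matrix.map_map, transpose_map] using! h
  obtain ⟨f, hf⟩ := ZMod.exists_equivariant_choice
    (X := Matrix (Fin m) (Fin m) ℂ × Matrix (Fin m) (Fin n) ℂ × Matrix (Fin n) (Fin n) ℂ)
    (fun x => (x.1.map star, x.2.1.map star, x.2.2.map star))
    (fun x => by simp only [hstar])
    (fun k x => x.1 ∈ unitaryGroup (Fin m) ℂ ∧ x.2.2 ∈ unitaryGroup (Fin n) ℂ ∧
      M k = x.1 * x.2.1 * x.2.2ᴴ ∧ ∀ (i : Fin m) (j : Fin n), (i : ℕ) ≠ j → x.2.1 i j = 0)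
    (fun k x ⟨hU, hV, hA, hS⟩ => ⟨hunit _ hU, hunit _ hV, by
      rw [hM, hA]
      ext i j
      simp [Matrix.mul_apply], fun i j hij => by simp [hS i j hij]⟩)
    (fun k => by
      obtain ⟨U, hU, V, hV, S, hA, hS⟩ := (M k).exists_svd
      exact ⟨(U, S, V), hU, hV, hA, hS⟩)
    (fun k hk => by
      have hreal : M k = ((M k).map Complex.re).map Complex.ofReal := by
        ext i j
        have h := congrFun₂ (hM k) i j
        rw [hk] at h
        exact (Complex.conj_eq_iff_re.1 h.symm).symm
      obtain ⟨U, hU, V, hV, S, hA, hS⟩ := ((M k).map Complex.re).exists_svd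
      have hreal_unit : ∀ {a : ℕ} (B : Matrix (Fin a) (Fin a) ℝ), B ∈ unitaryGroup (Fin a) ℝ →
          B.map Complex.ofReal ∈ unitaryGroup (Fin a) ℂ := by
        intro a B hB
        rw [mem_unitaryGroup_iff] at hB ⊢
        ext i j
        have h := congrArg Complex.ofReal (congrFun₂ hB i j)
        simpa [Matrix.mul_apply, Matrix.one_apply, apply_ite] using h
      refine ⟨(U.map Complex.ofReal, S.map Complex.ofReal, V.map Complex.ofReal),
        ⟨hreal_unit U hU, hreal_unit V hV, ?_, fun i j hij => by simp [hS i j hij]⟩, ?_⟩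
      · rw [hreal, hA]
        ext i j
        simp [Matrix.mul_apply]
      · refine Prod.ext ?_ (Prod.ext ?_ ?_) <;> ext i j <;> simp)
  exact ⟨fun k => (f k).1, fun k => (f k).2.1, fun k => (f k).2.2,
    fun k => congrArg Prod.fst (hf k).2, fun k => congrArg (fun x => x.2.1) (hf k).2,
    fun k => congrArg (fun x => x.2.2) (hf k).2, fun k => (hf k).1⟩

open ZMod

theorem ZMod.star_stdAddChar {N : ℕ} [NeZero N] (k : ZMod N) :
    star (stdAddChar k : ℂ) = stdAddChar (-k) := by
  rw [stdAddChar_apply, stdAddChar_apply, AddChar.map_neg_eq_inv, Circle.coe_inv_eq_conj]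
  rfl

/-- Conjugation-symmetric functions are the Fourier transforms of real functions. -/
theorem ZMod.exists_real_dft_eq {N : ℕ} [NeZero N] (f : ZMod N → ℂ)
    (hf : ∀ k, f (-k) = star (f k)) :
    ∃ g : ZMod N → ℝ, 𝓕 (fun k => (g k : ℂ)) = f := by
  have h : ∀ k, ((𝓕⁻ f k).re : ℂ) = 𝓕⁻ f k := by
    intro k
    rw [← Complex.conj_eq_iff_re, ← Complex.star_def, invDFT_apply, star_smul, star_sum]
    congr 1
    · simp
    · refine Fintype.sum_equiv (Equiv.neg _) _ _ fun j => ?_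
      simp [star_stdAddChar, hf]
  exact ⟨fun k => (𝓕⁻ f k).re, by rw [funext h]; exact LinearEquiv.apply_symm_apply _ _⟩

/-- The Fourier transform turns circular convolution into pointwise multiplication. -/
theorem ZMod.dft_convolution {N : ℕ} [NeZero N] (f g : ZMod N → ℂ) (k : ZMod N) :
    𝓕 (fun l => ∑ j, f j * g (l - j)) k = 𝓕 f k * 𝓕 g k := by
  simp only [dft_apply, smul_eq_mul]
  rw [Finset.sum_mul_sum]
  simp only [Finset.mul_sum]
  rw [Finset.sum_comm]
  refine Finset.sum_congr rfl fun j _ => Fintype.sum_equiv (Equiv.subRight j) _ _ fun l => ?_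
  rw [Equiv.subRight_apply, show -(l * k) = -(j * k) + -((l - j) * k) by ring,
    AddChar.map_add_eq_mul]
  ring

/-- The `k`-th frontal slice of the tensor of Fourier transforms of the tubes of `T`. -/
noncomputable def tubeDFT {a b n : ℕ} (T : Fin a → Fin b → Fin (n + 1) → ℝ) (k : ZMod (n + 1)) :
    Matrix (Fin a) (Fin b) ℂ :=
  Matrix.of fun i j => 𝓕 (fun l : ZMod (n + 1) => (T i j l : ℂ)) k

section tubeDFT

variable {a b c n : ℕ}

theorem tubeDFT_apply (T : Fin a → Fin b → Fin (n + 1) → ℝ) (k : ZMod (n + 1)) (i : Fin a)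
    (j : Fin b) : tubeDFT T k i j = 𝓕 (fun l : ZMod (n + 1) => (T i j l : ℂ)) k :=
  rfl

theorem tube_eq_of_tubeDFT_eq {T T' : Fin a → Fin b → Fin (n + 1) → ℝ} {i : Fin a} {j : Fin b}
    (h : ∀ k, tubeDFT T k i j = tubeDFT T' k i j) : T i j = T' i j := by
  have h' := (dft (N := n + 1) (E := ℂ)).injective (funext h)
  exact funext fun l => Complex.ofReal_injective (congrFun h' l)

theorem tubeDFT_injective :
    Function.Injective (tubeDFT : (Fin a → Fin b → Fin (n + 1) → ℝ) → _) := fun _ _ h =>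
  funext₂ fun i j => tube_eq_of_tubeDFT_eq fun k => congrFun₂ (congrFun h k) i j

theorem tubeDFT_tProd (A : Fin a → Fin b → Fin (n + 1) → ℝ) (B : Fin b → Fin c → Fin (n + 1) → ℝ)
    (k : ZMod (n + 1)) : tubeDFT (tProd A B) k = tubeDFT A k * tubeDFT B k := by
  ext i j
  have h : (fun l : ZMod (n + 1) => (tProd A B i j l : ℂ)) =
      ∑ p, fun l : ZMod (n + 1) => ∑ q : ZMod (n + 1), (A i p q : ℂ) *
        (fun r : ZMod (n + 1) => (B p j r : ℂ)) (l - q) := by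
    ext l
    simp only [tProd, Complex.ofReal_sum, Complex.ofReal_mul, Finset.sum_apply]
    rfl
  rw [tubeDFT_apply, h, map_sum, Finset.sum_apply, Matrix.mul_apply]
  exact Finset.sum_congr rfl fun p _ =>
    dft_convolution (N := n + 1) (fun r => (A i p r : ℂ)) (fun r => (B p j r : ℂ)) k

theorem tubeDFT_neg (T : Fin a → Fin b → Fin (n + 1) → ℝ) (k : ZMod (n + 1)) :
    tubeDFT T (-k) = (tubeDFT T k).map star := by
  ext i j
  rw [Matrix.map_apply, tubeDFT_apply, tubeDFT_apply, dft_apply, dft_apply, star_sum]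
  exact Finset.sum_congr rfl fun l _ => by simp [star_stdAddChar]

theorem tubeDFT_ttrans (T : Fin a → Fin b → Fin (n + 1) → ℝ) (k : ZMod (n + 1)) :
    tubeDFT (ttrans T) k = (tubeDFT T k)ᴴ := by
  ext i j
  rw [conjTranspose_apply]
  exact (congrFun (dft_comp_neg fun l : ZMod (n + 1) => (T j i l : ℂ)) k).trans
    (congrFun₂ (tubeDFT_neg T k) j i)

theorem tubeDFT_tid (k : ZMod (n + 1)) : tubeDFT (tid a (n + 1)) k = 1 := by
  ext i j
  rw [tubeDFT_apply, dft_apply, Fintype.sum_eq_single 0]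
  · have h0 : @Fin.val (n + 1) (0 : ZMod (n + 1)) = 0 := rfl
    simp [tid, h0, Matrix.one_apply, apply_ite]
  · intro l hl
    have hl' : @Fin.val (n + 1) l ≠ 0 := fun h => hl (Fin.ext h)
    simp [tid, hl']

theorem exists_tubeDFT_eq (M : ZMod (n + 1) → Matrix (Fin a) (Fin b) ℂ)
    (hM : ∀ k, M (-k) = (M k).map star) :
    ∃ T : Fin a → Fin b → Fin (n + 1) → ℝ, tubeDFT T = M := by
  choose T hT using fun i j => ZMod.exists_real_dft_eq (fun k => M k i j)
    fun k => congrFun₂ (hM k) i j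
  exact ⟨T, funext fun k => Matrix.ext fun i j => congrFun (hT i j) k⟩

theorem tProd_ttrans_eq_tid {U : Fin a → Fin a → Fin (n + 1) → ℝ}
    (hU : ∀ k, tubeDFT U k ∈ unitaryGroup (Fin a) ℂ) : tProd U (ttrans U) = tid a (n + 1) :=
  tubeDFT_injective <| funext fun k => by
    rw [tubeDFT_tProd, tubeDFT_ttrans, tubeDFT_tid]
    exact mem_unitaryGroup_iff.1 (hU k)

theorem ttrans_tProd_eq_tid {U : Fin a → Fin a → Fin (n + 1) → ℝ}
    (hU : ∀ k, tubeDFT U k ∈ unitaryGroup (Fin a) ℂ) : tProd (ttrans U) U = tid a (n + 1) :=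
  tubeDFT_injective <| funext fun k => by
    rw [tubeDFT_tProd, tubeDFT_ttrans, tubeDFT_tid]
    exact mem_unitaryGroup_iff'.1 (hU k)

end tubeDFT

/-- t-SVD.  Every real 3-order tensor `A ∈ ℝ^{I₁×I₂×I₃}` can
be factored as `A = U ∗ S ∗ Vᵀ` where `U ∈ ℝ^{I₁×I₁×I₃}` and `V ∈ ℝ^{I₂×I₂×I₃}`
are orthogonal in the t-product sense and `S ∈ ℝ^{I₁×I₂×I₃}` is f-diagonal
(every frontal slice is a diagonal matrix). -/
theorem tsvd_exists (I₁ I₂ I₃ : ℕ) (A : Fin I₁ → Fin I₂ → Fin I₃ → ℝ) :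
    ∃ (U : Fin I₁ → Fin I₁ → Fin I₃ → ℝ)
      (S : Fin I₁ → Fin I₂ → Fin I₃ → ℝ)
      (V : Fin I₂ → Fin I₂ → Fin I₃ → ℝ),
      A = tProd U (tProd S (ttrans V)) ∧
      tProd U (ttrans U) = tid I₁ I₃ ∧
      tProd (ttrans U) U = tid I₁ I₃ ∧
      tProd V (ttrans V) = tid I₂ I₃ ∧
      tProd (ttrans V) V = tid I₂ I₃ ∧
      (∀ (i : Fin I₁) (j : Fin I₂) (k : Fin I₃), (i : ℕ) ≠ (j : ℕ) → S i j k = 0) := by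
  obtain _ | n := I₃
  · have h : ∀ {a b : ℕ} (X Y : Fin a → Fin b → Fin 0 → ℝ), X = Y := fun X Y => by
      ext i j k
      exact k.elim0
    exact ⟨fun _ _ _ => 0, fun _ _ _ => 0, fun _ _ _ => 0, h _ _, h _ _, h _ _, h _ _, h _ _,
      fun _ _ k => k.elim0⟩
  obtain ⟨U', S', V', hU', hS', hV', h⟩ :=
    Matrix.exists_svd_of_map_star (tubeDFT A) (tubeDFT_neg A)
  obtain ⟨U, rfl⟩ := exists_tubeDFT_eq U' hU'
  obtain ⟨S, rfl⟩ := exists_tubeDFT_eq S' hS'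
  obtain ⟨V, rfl⟩ := exists_tubeDFT_eq V' hV'
  refine ⟨U, S, V, tubeDFT_injective <| funext fun k => ?_,
    tProd_ttrans_eq_tid fun k => (h k).1, ttrans_tProd_eq_tid fun k => (h k).1,
    tProd_ttrans_eq_tid fun k => (h k).2.1, ttrans_tProd_eq_tid fun k => (h k).2.1,
    fun i j k hij => ?_⟩
  · rw [tubeDFT_tProd, tubeDFT_tProd, tubeDFT_ttrans, (h k).2.2.1, Matrix.mul_assoc]
  · have h0 : S i j = 0 :=
      tube_eq_of_tubeDFT_eq (T' := fun _ _ _ => 0) fun k => by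
        rw [(h k).2.2.2 i j hij, tubeDFT_apply, dft_apply]
        simp
    exact congrFun h0 k
end
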